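/- arXiv:2504.20638 — 2 statements merged into one kernel-verified Lean document; each statement's English description precedes it below -/
import Mathlib

section
/- Let P be a finite-dimensional Poisson algebra over a field of characteristic zero with solvable radical R. Then R^2 = R·R + [R,R] is nilpotent. -/
/-!  Framework: dialgebras and Poisson algebras as bilinear structures on a module. -/

variable {F P : Type*} [Field F] [AddCommGroup P] [Module F P]

/-- A dialgebra: a vector space with two bilinear multiplications. -/
structure Dialgebra (F P : Type*) [Field F] [AddCommGroup P] [Module F P] where
  mul : P →ₗ[F] P →ₗ[F] P
  bracket : P →ₗ[F] P →ₗ[F] P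

namespace Dialgebra

variable (D : Dialgebra F P)

/-- Span of the set of products `a·b`, `a ∈ A`, `b ∈ B`. -/
def pmul (A B : Submodule F P) : Submodule F P :=
  Submodule.span F (Set.image2 (fun a b => D.mul a b) (A : Set P) (B : Set P))

/-- Span of the set of brackets `[a,b]`, `a ∈ A`, `b ∈ B`. -/
def pbra (A B : Submodule F P) : Submodule F P :=
  Submodule.span F (Set.image2 (fun a b => D.bracket a b) (A : Set P) (B : Set P))

/-- `A·B + [A,B]`. -/
def psq (A B : Submodule F P) : Submodule F P := D.pmul A B ⊔ D.pbra A B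

/-- A subalgebra: a subspace closed under both products. -/
def IsSubalgebra (A : Submodule F P) : Prop := D.psq A A ≤ A

/-- An ideal of the dialgebra. -/
def IsIdeal (A : Submodule F P) : Prop :=
  D.pmul A ⊤ ≤ A ∧ D.pmul ⊤ A ≤ A ∧ D.pbra A ⊤ ≤ A ∧ D.pbra ⊤ A ≤ A

/-- `A` is an ideal of the subalgebra `U`. -/
def IsIdealIn (A U : Submodule F P) : Prop :=
  A ≤ U ∧ D.pmul A U ≤ A ∧ D.pmul U A ≤ A ∧ D.pbra A U ≤ A ∧ D.pbra U A ≤ A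

/-- Lower central series of `B`: `B^1 = B`, `B^{n+1} = B^n·B + [B^n,B]`. -/
def lcs (B : Submodule F P) : ℕ → Submodule F P
  | 0 => B
  | n + 1 => D.psq (lcs B n) B

/-- `B` is nilpotent as a dialgebra. -/
def IsNilpotentSub (B : Submodule F P) : Prop := ∃ n, D.lcs B n = ⊥

/-- Derived series of `B`. -/
def ders (B : Submodule F P) : ℕ → Submodule F P
  | 0 => B
  | n + 1 => D.psq (ders B n) (ders B n)

/-- `B` is solvable as a dialgebra. -/
def IsSolvableSub (B : Submodule F P) : Prop := ∃ n, D.ders B n = ⊥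

/-- Associative powers: `apow B n = B_A^{n+1}`, i.e. `apow B 0 = B_A^1 = B`. -/
def apow (B : Submodule F P) : ℕ → Submodule F P
  | 0 => B
  | n + 1 => D.pmul (apow B n) B

/-- Lie powers: `lpow B n = B_L^{n+1}`. -/
def lpow (B : Submodule F P) : ℕ → Submodule F P
  | 0 => B
  | n + 1 => D.pbra (lpow B n) B

/-- Associative nilpotency of `B`. -/
def AssocNilpotent (B : Submodule F P) : Prop := ∃ n, D.apow B n = ⊥

/-- Lie nilpotency of `B`. -/
def LieNilpotent (B : Submodule F P) : Prop := ∃ n, D.lpow B n = ⊥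

/-- `mulPows B X n = X·B_A^n` (with the convention that it is `X` for `n = 0`). -/
def mulPows (B X : Submodule F P) : ℕ → Submodule F P
  | 0 => X
  | n + 1 => D.pmul (mulPows B X n) B

/-- `M` is a maximal (proper) subalgebra of the subalgebra `U`. -/
def IsMaximalSubalgebraIn (U M : Submodule F P) : Prop :=
  D.IsSubalgebra M ∧ M < U ∧ ∀ K, D.IsSubalgebra K → M ≤ K → K ≤ U → K = M ∨ K = U

/-- Frattini subalgebra of the subalgebra `U`: intersection of its maximal subalgebras. -/
def frattiniIn (U : Submodule F P) : Submodule F P :=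
  U ⊓ sInf {M | D.IsMaximalSubalgebraIn U M}

/-- Frattini ideal of the subalgebra `U`: largest ideal of `U` inside `frattiniIn U`. -/
def phiIn (U : Submodule F P) : Submodule F P :=
  sSup {I | D.IsIdealIn I U ∧ I ≤ D.frattiniIn U}

/-- Frattini subalgebra of the dialgebra. -/
def frattini : Submodule F P := D.frattiniIn ⊤

/-- Frattini ideal of the dialgebra. -/
def phi : Submodule F P := sSup {I | D.IsIdeal I ∧ I ≤ D.frattini}

/-- Minimal ideal. -/
def IsMinimalIdeal (A : Submodule F P) : Prop :=
  D.IsIdeal A ∧ A ≠ ⊥ ∧ ∀ I, D.IsIdeal I → I ≤ A → I = ⊥ ∨ I = A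

/-- Zero (trivial-multiplication) subspace. -/
def IsZeroAlg (A : Submodule F P) : Prop := D.pmul A A = ⊥ ∧ D.pbra A A = ⊥

/-- Zero socle: sum of the minimal zero ideals. -/
def zsoc : Submodule F P := sSup {A | D.IsMinimalIdeal A ∧ D.IsZeroAlg A}

/-- Socle: sum of the minimal ideals. -/
def soc : Submodule F P := sSup {A | D.IsMinimalIdeal A}

/-- Annihilator of `B` in the algebra. -/
def annih (B : Submodule F P) : Submodule F P where
  carrier := {x | ∀ b ∈ B, D.mul x b = 0 ∧ D.bracket x b = 0}
  add_mem' := by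
    intro x y hx hy b hb
    have h1 := hx b hb; have h2 := hy b hb
    constructor <;> simp [map_add, LinearMap.add_apply, h1.1, h1.2, h2.1, h2.2]
  zero_mem' := by intro b hb; simp
  smul_mem' := by
    intro c x hx b hb
    have h := hx b hb
    constructor <;> simp [map_smul, LinearMap.smul_apply, h.1, h.2]

/-- `R` is the solvable radical: the largest solvable ideal. -/
def IsRadical (R : Submodule F P) : Prop :=
  D.IsIdeal R ∧ D.IsSolvableSub R ∧ ∀ I, D.IsIdeal I → D.IsSolvableSub I → I ≤ R

/-- `N` is the nilradical: the largest nilpotent ideal. -/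
def IsNilradical (N : Submodule F P) : Prop :=
  D.IsIdeal N ∧ D.IsNilpotentSub N ∧ ∀ I, D.IsIdeal I → D.IsNilpotentSub I → I ≤ N

end Dialgebra

/-- A Poisson algebra: commutative associative product and Lie bracket linked by the Leibniz rule. -/
structure PoissonAlgebra (F P : Type*) [Field F] [AddCommGroup P] [Module F P]
    extends Dialgebra F P where
  mul_comm : ∀ x y, mul x y = mul y x
  mul_assoc : ∀ x y z, mul (mul x y) z = mul x (mul y z)
  lie_self : ∀ x, bracket x x = 0
  leibniz_lie : ∀ x y z, bracket x (bracket y z) = bracket (bracket x y) z + bracket y (bracket x z)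
  leibniz : ∀ x y z, bracket (mul x y) z = mul (bracket x z) y + mul x (bracket y z)

open scoped TensorProduct in
/-- A nonzero module over a solvable Lie algebra in characteristic zero admits a nonzero functional,
with values in an algebraic closure, that vanishes on the action of all commutators. -/
theorem LieModule.exists_functional_vanishing_on_commutators (F L V : Type*) [Field F] [CharZero F]
    [LieRing L] [LieAlgebra F L] [LieAlgebra.IsSolvable L] [AddCommGroup V] [Module F V]
    [FiniteDimensional F V] [LieRingModule L V] [LieModule F L V] [Nontrivial V] :
    ∃ g : V →ₗ[F] AlgebraicClosure F, g ≠ 0 ∧ ∀ (a b : L) (v : V), g ⁅⁅a, b⁆, v⁆ = 0 := by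
  let K := AlgebraicClosure F
  obtain ⟨χ, hχ⟩ := LieModule.exists_nontrivial_weightSpace_of_isSolvable K (K ⊗[F] L)
    (Module.Dual K (K ⊗[F] V))
  obtain ⟨⟨f, hf⟩, hf0⟩ := exists_ne (0 : LieModule.weightSpace (Module.Dual K (K ⊗[F] V)) χ)
  rw [LieModule.mem_weightSpace] at hf
  have hact : ∀ (a : L) (v : V), f (1 ⊗ₜ ⁅a, v⁆) = -(χ (1 ⊗ₜ a) * f (1 ⊗ₜ v)) := by
    intro a v
    have h := LinearMap.congr_fun (hf (1 ⊗ₜ a)) (1 ⊗ₜ v)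
    rw [Module.Dual.lie_apply, LieAlgebra.ExtendScalars.bracket_tmul, mul_one,
      LinearMap.smul_apply, smul_eq_mul] at h
    rw [← h, neg_neg]
  refine ⟨(f.restrictScalars F).comp (TensorProduct.mk F K V 1), fun h0 ↦ hf0 ?_, fun a b v ↦ ?_⟩
  · apply Subtype.ext
    change f = 0
    ext v
    simpa using LinearMap.congr_fun h0 v
  · change f (1 ⊗ₜ ⁅⁅a, b⁆, v⁆) = 0
    rw [lie_lie, TensorProduct.tmul_sub, map_sub, hact, hact, hact, hact]
    ring

/-- An antitone sequence of subspaces which can only stall at zero reaches zero. -/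
theorem Submodule.exists_eq_bot_of_antitone {F P : Type*} [Field F] [AddCommGroup P] [Module F P]
    [FiniteDimensional F P] (f : ℕ → Submodule F P) (hf : Antitone f)
    (h : ∀ n, f n ≤ f (n + 1) → f n = ⊥) : ∃ n, f n = ⊥ := by
  obtain ⟨n, hn⟩ := IsArtinian.monotone_stabilizes (R := F) (M := P)
    ⟨fun n ↦ OrderDual.toDual (f n), fun _ _ hab ↦ hf hab⟩
  have hn' : f n = f (n + 1) := hn (n + 1) n.le_succ
  exact ⟨n, h n hn'.le⟩

namespace Dialgebra

variable (D : Dialgebra F P)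

theorem pmul_eq_map₂ (A B : Submodule F P) : D.pmul A B = Submodule.map₂ D.mul A B :=
  (Submodule.map₂_eq_span_image2 _ _ _).symm

theorem pbra_eq_map₂ (A B : Submodule F P) : D.pbra A B = Submodule.map₂ D.bracket A B :=
  (Submodule.map₂_eq_span_image2 _ _ _).symm

variable {D}
variable {A B C A' B' : Submodule F P}

theorem mul_mem_pmul {a b : P} (ha : a ∈ A) (hb : b ∈ B) : D.mul a b ∈ D.pmul A B :=
  Submodule.subset_span ⟨a, ha, b, hb, rfl⟩

theorem bracket_mem_pbra {a b : P} (ha : a ∈ A) (hb : b ∈ B) : D.bracket a b ∈ D.pbra A B :=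
  Submodule.subset_span ⟨a, ha, b, hb, rfl⟩

theorem pmul_le : D.pmul A B ≤ C ↔ ∀ a ∈ A, ∀ b ∈ B, D.mul a b ∈ C := by
  rw [pmul_eq_map₂, Submodule.map₂_le]

theorem pbra_le : D.pbra A B ≤ C ↔ ∀ a ∈ A, ∀ b ∈ B, D.bracket a b ∈ C := by
  rw [pbra_eq_map₂, Submodule.map₂_le]

theorem pmul_mono (hA : A ≤ A') (hB : B ≤ B') : D.pmul A B ≤ D.pmul A' B' :=
  pmul_le.2 fun _ ha _ hb ↦ mul_mem_pmul (hA ha) (hB hb)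

theorem pbra_mono (hA : A ≤ A') (hB : B ≤ B') : D.pbra A B ≤ D.pbra A' B' :=
  pbra_le.2 fun _ ha _ hb ↦ bracket_mem_pbra (hA ha) (hB hb)

theorem IsIdeal.mul_mem (hA : D.IsIdeal A) {a : P} (ha : a ∈ A) (p : P) : D.mul a p ∈ A :=
  hA.1 (mul_mem_pmul ha trivial)

theorem IsIdeal.bracket_mem (hA : D.IsIdeal A) {a : P} (ha : a ∈ A) (p : P) : D.bracket p a ∈ A :=
  hA.2.2.2 (bracket_mem_pbra trivial ha)

theorem IsIdeal.psq_le (hA : D.IsIdeal A) : D.psq A A ≤ A :=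
  sup_le (pmul_le.2 fun _ ha b _ ↦ hA.mul_mem ha b) (pbra_le.2 fun a _ _ hb ↦ hA.bracket_mem hb a)

variable (D) in
/-- Iterated brackets `[⋯[[P, B], B]⋯, B]` with `n` factors `B`. -/
def braPows (B : Submodule F P) : ℕ → Submodule F P
  | 0 => ⊤
  | n + 1 => D.pbra (braPows B n) B

theorem braPows_antitone (B : Submodule F P) : Antitone (D.braPows B) := by
  refine antitone_nat_of_succ_le fun n ↦ ?_
  induction n with
  | zero => exact le_top
  | succ n ih => exact pbra_mono ih le_rfl

theorem mulPows_top_antitone (B : Submodule F P) : Antitone (D.mulPows B ⊤) := by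
  refine antitone_nat_of_succ_le fun n ↦ ?_
  induction n with
  | zero => exact le_top
  | succ n ih => exact pmul_mono ih le_rfl

end Dialgebra

namespace PoissonAlgebra

open Dialgebra

variable (Q : PoissonAlgebra F P)

/-- The Lie ring underlying a Poisson algebra. -/
abbrev lieRing : LieRing P where
  bracket x y := Q.bracket x y
  add_lie x y z := by change Q.bracket (x + y) z = _; simp
  lie_add x y z := map_add (Q.bracket x) y z
  lie_self := Q.lie_self
  leibniz_lie := Q.leibniz_lie

/-- The Lie algebra underlying a Poisson algebra. -/
abbrev lieAlgebra : letI := Q.lieRing; LieAlgebra F P :=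
  letI := Q.lieRing
  { lie_smul := fun t x y ↦ map_smul (Q.bracket x) t y }

variable {Q}

theorem bracket_swap (x y : P) : Q.bracket x y = -Q.bracket y x := by
  have h := Q.lie_self (x + y)
  simp only [map_add, LinearMap.add_apply, Q.lie_self, zero_add, add_zero] at h
  exact eq_neg_of_add_eq_zero_right h

theorem bracket_mul (x y z : P) :
    Q.bracket x (Q.mul y z) = Q.mul (Q.bracket x y) z + Q.mul y (Q.bracket x z) := by
  rw [bracket_swap, Q.leibniz, bracket_swap x y, bracket_swap x z]
  simp [add_comm]

variable {A B R X : Submodule F P}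

theorem bracket_mem_of_pbra (hA : ∀ p, ∀ a ∈ A, Q.bracket p a ∈ A)
    (hB : ∀ p, ∀ b ∈ B, Q.bracket p b ∈ B) (p : P) :
    ∀ x ∈ Q.pbra A B, Q.bracket p x ∈ Q.pbra A B := by
  suffices Q.pbra A B ≤ (Q.pbra A B).comap (Q.bracket p) from this
  refine pbra_le.2 fun a ha b hb ↦ ?_
  rw [Submodule.mem_comap, Q.leibniz_lie]
  exact add_mem (bracket_mem_pbra (hA p a ha) hb) (bracket_mem_pbra ha (hB p b hb))

theorem bracket_mem_of_pmul (hA : ∀ p, ∀ a ∈ A, Q.bracket p a ∈ A)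
    (hB : ∀ p, ∀ b ∈ B, Q.bracket p b ∈ B) (p : P) :
    ∀ x ∈ Q.pmul A B, Q.bracket p x ∈ Q.pmul A B := by
  suffices Q.pmul A B ≤ (Q.pmul A B).comap (Q.bracket p) from this
  refine pmul_le.2 fun a ha b hb ↦ ?_
  rw [Submodule.mem_comap, bracket_mul]
  exact add_mem (mul_mem_pmul (hA p a ha) hb) (mul_mem_pmul ha (hB p b hb))

/-- A Lie ideal `X` with `X ≤ [X, [R, R]]`, where `R` is a solvable ideal, vanishes. -/
theorem eq_bot_of_le_pbra [CharZero F] [FiniteDimensional F P]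
    (hR : ∀ p, ∀ r ∈ R, Q.bracket p r ∈ R) (hs : Q.IsSolvableSub R)
    (hX : ∀ p, ∀ x ∈ X, Q.bracket p x ∈ X) (h : X ≤ Q.pbra X (Q.pbra R R)) : X = ⊥ := by
  let := Q.lieRing
  let := Q.lieAlgebra
  let I : LieIdeal F P := { R with lie_mem := fun {p r} hr ↦ hR p r hr }
  let N : LieIdeal F P := { X with lie_mem := fun {p x} hx ↦ hX p x hx }
  have hder : ∀ n, (LieAlgebra.derivedSeriesOfIdeal F P n I).toSubmodule ≤ Q.ders R n := by
    intro n
    induction n with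
    | zero => exact le_rfl
    | succ n ih =>
      rw [LieAlgebra.derivedSeriesOfIdeal_succ, LieSubmodule.lieIdeal_oper_eq_linear_span',
        Submodule.span_le]
      rintro _ ⟨x, hx, y, hy, rfl⟩
      exact (le_sup_right : _ ≤ Q.psq _ _) (bracket_mem_pbra (ih hx) (ih hy))
  have : LieAlgebra.IsSolvable I := by
    obtain ⟨n, hn⟩ := hs
    refine LieAlgebra.IsSolvable.mk (R := F) (k := n)
      ((LieIdeal.derivedSeries_eq_bot_iff I n).2 ?_)
    rw [← LieSubmodule.toSubmodule_eq_bot, eq_bot_iff, ← hn]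
    exact hder n
  by_contra hne
  have : Nontrivial N := (Submodule.nontrivial_iff_ne_bot (p := X)).2 hne
  obtain ⟨g, hg0, hg⟩ := LieModule.exists_functional_vanishing_on_commutators F I N
  have hker : Q.pbra X (Q.pbra R R) ≤ (LinearMap.ker g).map X.subtype := by
    refine pbra_le.2 fun x hx c hc ↦ ?_
    suffices Q.pbra R R ≤ ((LinearMap.ker g).map X.subtype).comap (Q.bracket x) from this hc
    refine pbra_le.2 fun a ha b hb ↦ ?_
    rw [Submodule.mem_comap, bracket_swap, neg_mem_iff]
    exact ⟨_, hg ⟨a, ha⟩ ⟨b, hb⟩ ⟨x, hx⟩, rfl⟩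
  refine hg0 (LinearMap.ext fun v ↦ ?_)
  obtain ⟨w, hw, hwv⟩ := hker (h v.2)
  have : w = v := Subtype.ext hwv
  exact this ▸ hw

/-- A subspace `X` with `X ≤ X · R`, where `R` is solvable, vanishes. -/
theorem eq_bot_of_le_pmul (hs : Q.IsSolvableSub R) (h : X ≤ Q.pmul X R) : X = ⊥ := by
  have hder : ∀ n, X ≤ Q.pmul X (Q.ders R n) := by
    intro n
    induction n with
    | zero => exact h
    | succ n ih =>
      refine (ih.trans (pmul_mono ih le_rfl)).trans (pmul_le.2 fun y hy s hs ↦ ?_)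
      suffices Q.pmul X (Q.ders R n) ≤ (Q.pmul X (Q.ders R (n + 1))).comap (Q.mul.flip s) from
        this hy
      refine pmul_le.2 fun x hx t ht ↦ ?_
      rw [Submodule.mem_comap, LinearMap.flip_apply, Q.mul_assoc]
      exact mul_mem_pmul hx ((le_sup_left : _ ≤ Q.psq _ _) (mul_mem_pmul ht hs))
  obtain ⟨n, hn⟩ := hs
  have hX := hder n
  rw [hn, pmul_eq_map₂, Submodule.map₂_bot_right] at hX
  exact eq_bot_iff.2 hX

theorem bracket_mem_braPows (hB : ∀ p, ∀ b ∈ B, Q.bracket p b ∈ B) (n : ℕ) :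
    ∀ p, ∀ x ∈ Q.braPows B n, Q.bracket p x ∈ Q.braPows B n := by
  induction n with
  | zero => exact fun _ _ _ ↦ trivial
  | succ n ih => exact bracket_mem_of_pbra ih hB

theorem bracket_mem_mulPows_top (hB : ∀ p, ∀ b ∈ B, Q.bracket p b ∈ B) (n : ℕ) :
    ∀ p, ∀ x ∈ Q.mulPows B ⊤ n, Q.bracket p x ∈ Q.mulPows B ⊤ n := by
  induction n with
  | zero => exact fun _ _ _ ↦ trivial
  | succ n ih => exact bracket_mem_of_pmul ih hB

/-- Multiplying by `R² = R·R + [R,R]` moves the filtration `P·Rⁱ` up one step, modulo brackets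
with `[R,R]`. -/
theorem psq_le_mulPows_sup (hR : Q.IsIdeal R) {Y : Submodule F P} {i j : ℕ}
    (hY : Y ≤ Q.mulPows R ⊤ (i + 1) ⊔ (Q.mulPows R ⊤ i ⊓ Q.braPows (Q.pbra R R) j)) :
    Q.psq Y (Q.psq R R) ≤
      Q.mulPows R ⊤ (i + 1) ⊔ (Q.mulPows R ⊤ i ⊓ Q.braPows (Q.pbra R R) (j + 1)) := by
  have hanti := mulPows_top_antitone (D := Q.toDialgebra) R
  have hlie := bracket_mem_mulPows_top (Q := Q) (B := R) fun p r hr ↦ hR.bracket_mem hr p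
  have hlie' : ∀ n, ∀ x ∈ Q.mulPows R ⊤ n, ∀ p, Q.bracket x p ∈ Q.mulPows R ⊤ n := by
    intro n x hx p
    rw [bracket_swap]
    exact neg_mem (hlie n p x hx)
  have hYi : Y ≤ Q.mulPows R ⊤ i := hY.trans (sup_le (hanti i.le_succ) inf_le_left)
  refine sup_le ((pmul_mono hYi hR.psq_le).trans le_sup_left) (pbra_le.2 fun y hy b hb ↦ ?_)
  obtain ⟨u, hu, w, ⟨hwi, hwj⟩, rfl⟩ := Submodule.mem_sup.1 (hY hy)
  obtain ⟨r, hr, c, hc, rfl⟩ := Submodule.mem_sup.1 hb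
  rw [map_add Q.bracket, LinearMap.add_apply, map_add (Q.bracket w)]
  refine add_mem (Submodule.mem_sup_left (hlie' _ u hu _)) (add_mem (Submodule.mem_sup_left ?_)
    (Submodule.mem_sup_right ⟨hlie' _ w hwi c, bracket_mem_pbra hwj hc⟩))
  suffices Q.pmul R R ≤ (Q.mulPows R ⊤ (i + 1)).comap (Q.bracket w) from this hr
  refine pmul_le.2 fun x hx z hz ↦ ?_
  rw [Submodule.mem_comap, bracket_mul, Q.mul_comm x]
  exact add_mem (mul_mem_pmul (hlie' _ w hwi x) hz) (mul_mem_pmul (hlie' _ w hwi z) hx)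

/-- In characteristic zero, the square of a solvable ideal is nilpotent. -/
theorem isNilpotentSub_psq [CharZero F] [FiniteDimensional F P] (hR : Q.IsIdeal R)
    (hs : Q.IsSolvableSub R) : Q.IsNilpotentSub (Q.psq R R) := by
  have hlie : ∀ p, ∀ r ∈ R, Q.bracket p r ∈ R := fun p r hr ↦ hR.bracket_mem hr p
  have hlie₂ := bracket_mem_of_pbra hlie hlie
  obtain ⟨m, hm⟩ := Submodule.exists_eq_bot_of_antitone _ (braPows_antitone (Q.pbra R R))
    fun n hn ↦ eq_bot_of_le_pbra hlie hs (bracket_mem_braPows hlie₂ n) hn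
  obtain ⟨k, hk⟩ := Submodule.exists_eq_bot_of_antitone _ (mulPows_top_antitone R)
    fun n hn ↦ eq_bot_of_le_pmul hs hn
  have hstep : ∀ i s, Q.lcs (Q.psq R R) s ≤ Q.mulPows R ⊤ i → ∀ j, Q.lcs (Q.psq R R) (s + j) ≤
      Q.mulPows R ⊤ (i + 1) ⊔ (Q.mulPows R ⊤ i ⊓ Q.braPows (Q.pbra R R) j) := by
    intro i s hi j
    induction j with
    | zero => exact (le_inf hi le_top).trans le_sup_right
    | succ j ih => exact psq_le_mulPows_sup hR ih
  have hfil : ∀ i, ∃ s, Q.lcs (Q.psq R R) s ≤ Q.mulPows R ⊤ i := by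
    intro i
    induction i with
    | zero => exact ⟨0, le_top⟩
    | succ i ih =>
      obtain ⟨s, hi⟩ := ih
      refine ⟨s + m, (hstep i s hi m).trans ?_⟩
      rw [hm, inf_bot_eq, sup_bot_eq]
  obtain ⟨s, hs⟩ := hfil k
  exact ⟨s, eq_bot_iff.2 (hk ▸ hs)⟩

end PoissonAlgebra

/-- In characteristic zero, the square `R^2 = R·R + [R,R]` of the solvable radical
is nilpotent. -/
theorem radical_square_nilpotent_char_zero {F P : Type*} [Field F] [CharZero F]
    [AddCommGroup P] [Module F P] [FiniteDimensional F P]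
    (Q : PoissonAlgebra F P) (R : Submodule F P) (hR : Q.toDialgebra.IsRadical R) :
    Q.toDialgebra.IsNilpotentSub (Q.toDialgebra.psq R R) := by
  exact PoissonAlgebra.isNilpotentSub_psq hR.1 hR.2.1
end

section
/- Let P be a Poisson algebra over a field F and a ∈ P. The set S_P(a,F) of elements x ∈ P such that some product ∏_{i=1}^n (ad a − λ_i · id) annihilates x for scalars λ_1,...,λ_n ∈ F, is a Poisson subalgebra of P. -/
/-!  Framework: dialgebras and Poisson algebras as bilinear structures on a module. -/

variable {F P : Type*} [Field F] [AddCommGroup P] [Module F P]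

namespace Module.End

open Polynomial

/-- The vectors annihilated by `∏ (T - λ)`, the product running over the multiset `s`. -/
noncomputable def annihilatedBy (T : Module.End F P) (s : Multiset F) : Submodule F P :=
  LinearMap.ker (aeval T (s.map fun r => X - C r).prod)

/-- The vectors annihilated by some product of operators `T - λ`. -/
def IsSplitVector (T : Module.End F P) (x : P) : Prop :=
  ∃ s : Multiset F, x ∈ annihilatedBy T s

lemma mem_annihilatedBy_cons (T : Module.End F P) (r : F) (s : Multiset F) (x : P) :
    x ∈ annihilatedBy T (r ::ₘ s) ↔ T x - r • x ∈ annihilatedBy T s := by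
  simp [annihilatedBy, mul_comm (X - C r), Algebra.algebraMap_eq_smul_one]

lemma annihilatedBy_le_add (T : Module.End F P) (s t : Multiset F) :
    annihilatedBy T s ≤ annihilatedBy T (s + t) := by
  intro x hx
  rw [annihilatedBy, LinearMap.mem_ker] at hx ⊢
  rw [Multiset.map_add, Multiset.prod_add, mul_comm, map_mul, Module.End.mul_apply, hx, map_zero]

lemma isSplitVector_zero (T : Module.End F P) : IsSplitVector T 0 :=
  ⟨0, Submodule.zero_mem _⟩

lemma IsSplitVector.add {T : Module.End F P} {x y : P}
    (hx : IsSplitVector T x) (hy : IsSplitVector T y) : IsSplitVector T (x + y) := by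
  obtain ⟨s, hs⟩ := hx
  obtain ⟨t, ht⟩ := hy
  exact ⟨s + t, Submodule.add_mem _ (annihilatedBy_le_add T s t hs)
    (add_comm t s ▸ annihilatedBy_le_add T t s ht)⟩

lemma IsSplitVector.smul {T : Module.End F P} {x : P} (c : F)
    (hx : IsSplitVector T x) : IsSplitVector T (c • x) :=
  hx.imp fun _ hs => Submodule.smul_mem _ c hs

lemma IsSplitVector.of_sub_smul {T : Module.End F P} {x : P} (r : F)
    (hx : IsSplitVector T (T x - r • x)) : IsSplitVector T x := by
  obtain ⟨s, hs⟩ := hx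
  exact ⟨r ::ₘ s, (mem_annihilatedBy_cons T r s x).2 hs⟩

/-- Split vectors are closed under every bilinear product of which `T` is a derivation. -/
lemma IsSplitVector.bilinear {T : Module.End F P} (B : P →ₗ[F] P →ₗ[F] P)
    (hB : ∀ x y, T (B x y) = B (T x) y + B x (T y)) {x y : P}
    (hx : IsSplitVector T x) (hy : IsSplitVector T y) : IsSplitVector T (B x y) := by
  obtain ⟨s, hs⟩ := hx
  obtain ⟨t, ht⟩ := hy
  induction s using Multiset.induction_on generalizing x y t with
  | empty =>
    have hx : x = 0 := by simpa [annihilatedBy] using hs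
    simpa [hx] using isSplitVector_zero T
  | cons r s ihs =>
    induction t using Multiset.induction_on generalizing y with
    | empty =>
      have hy : y = 0 := by simpa [annihilatedBy] using ht
      simpa [hy] using isSplitVector_zero T
    | cons q t iht =>
      refine .of_sub_smul (r + q) ?_
      have h : T (B x y) - (r + q) • B x y = B (T x - r • x) y + B x (T y - q • y) := by
        simp only [hB, map_sub, map_smul, LinearMap.sub_apply, LinearMap.smul_apply, add_smul]
        abel
      rw [h]
      exact .add (ihs ((mem_annihilatedBy_cons T r s x).1 hs) _ ht)
        (iht ((mem_annihilatedBy_cons T q t y).1 ht))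

lemma list_prod_sub_smul_one (T : Module.End F P) (l : List F) :
    (l.map fun r => T - r • (1 : Module.End F P)).prod =
      aeval T (((l : Multiset F).map fun r => X - C r).prod) := by
  simp [map_list_prod, Function.comp_def, Algebra.algebraMap_eq_smul_one]

lemma isSplitVector_iff_exists_fin (T : Module.End F P) (x : P) :
    IsSplitVector T x ↔ ∃ (n : ℕ) (lam : Fin n → F),
      (List.ofFn fun i => (T - lam i • (1 : Module.End F P))).prod x = 0 := by
  constructor
  · rintro ⟨s, hs⟩
    induction s using Quotient.inductionOn with
    | h l =>
      refine ⟨l.length, l.get, ?_⟩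
      have h : (List.ofFn fun i => T - l.get i • (1 : Module.End F P)) =
          l.map fun r => T - r • (1 : Module.End F P) := by
        simpa [Function.comp_def] using
          (List.map_ofFn (f := l.get) (g := fun r => T - r • (1 : Module.End F P))).symm
      rw [h, list_prod_sub_smul_one]
      exact hs
  · rintro ⟨n, lam, h⟩
    refine ⟨(List.ofFn lam : List F), ?_⟩
    rw [annihilatedBy, LinearMap.mem_ker, ← list_prod_sub_smul_one, List.map_ofFn]
    exact h

end Module.End

lemma PoissonAlgebra.bracket_skew {F P : Type*} [Field F] [AddCommGroup P] [Module F P]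
    (Q : PoissonAlgebra F P) (x y : P) : Q.bracket x y = -Q.bracket y x := by
  have h := Q.lie_self (x + y)
  simp only [map_add, LinearMap.add_apply, Q.lie_self, zero_add, add_zero] at h
  exact eq_neg_of_add_eq_zero_right h

lemma PoissonAlgebra.bracket_mul_s10 {F P : Type*} [Field F] [AddCommGroup P] [Module F P]
    (Q : PoissonAlgebra F P) (a x y : P) :
    Q.bracket a (Q.mul x y) = Q.mul (Q.bracket a x) y + Q.mul x (Q.bracket a y) := by
  rw [Q.bracket_skew a, Q.leibniz, Q.bracket_skew x a, Q.bracket_skew y a]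
  simp only [map_neg, LinearMap.neg_apply]
  abel

/-- The set `S_P(a,F)` of elements killed by some product `∏ (ad a - λ_i)` with
`λ_i ∈ F` is a Poisson subalgebra. -/
theorem S_subalgebra {F P : Type*} [Field F] [AddCommGroup P] [Module F P]
    (Q : PoissonAlgebra F P) (a : P) :
    let S : Set P := {x | ∃ (n : ℕ) (lam : Fin n → F),
      (List.ofFn fun i => ((Q.bracket a : Module.End F P) - lam i • 1)).prod x = 0}
    (∀ x ∈ S, ∀ y ∈ S, x + y ∈ S) ∧ (∀ (c : F), ∀ x ∈ S, c • x ∈ S) ∧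
    (∀ x ∈ S, ∀ y ∈ S, Q.mul x y ∈ S ∧ Q.bracket x y ∈ S) := by
  intro S
  have hS (x : P) : x ∈ S ↔ Module.End.IsSplitVector (Q.bracket a) x :=
    (Module.End.isSplitVector_iff_exists_fin (Q.bracket a) x).symm
  simp only [hS]
  exact ⟨fun _ hx _ hy => hx.add hy, fun c _ hx => hx.smul c, fun _ hx _ hy =>
    ⟨hx.bilinear Q.mul (Q.bracket_mul_s10 a) hy, hx.bilinear Q.bracket (Q.leibniz_lie a) hy⟩⟩
end
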